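/- arXiv:2502.12934 — 2 statements merged into one kernel-verified Lean document; each statement's English description precedes it below -/
import Mathlib

section
/- For any element ψ of the tensor product H₁ ⊗ H₂ of two separable complex Hilbert spaces, there exist orthonormal families (eₖ) in H₁ and (fₖ) in H₂ (indexed by k < N for some N ∈ ℕ ∪ {∞}) and nonnegative real numbers λₖ tending to 0 (when N = ∞) such that ψ = Σₖ λₖ (eₖ ⊗ fₖ), with convergence in the norm of H₁ ⊗ H₂. -/
open scoped ComplexInnerProductSpace
open Filter Topology

namespace SchmidtAux

/-- The partial contraction `A φ a` characterised by `⟪b, A φ a⟫ = ⟪a ⊗ b, φ⟫`. -/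
theorem exists_contraction
    {H1 H2 E : Type*}
    [NormedAddCommGroup H1] [InnerProductSpace ℂ H1]
    [NormedAddCommGroup H2] [InnerProductSpace ℂ H2] [CompleteSpace H2]
    [NormedAddCommGroup E] [InnerProductSpace ℂ E] [CompleteSpace E]
    (tmul : H1 →ₗ[ℂ] H2 →ₗ[ℂ] E)
    (h_inner : ∀ (a c : H1) (b d : H2), ⟪tmul a b, tmul c d⟫ = ⟪a, c⟫ * ⟪b, d⟫) :
    ∃ A : E →L[ℂ] H1 →L⋆[ℂ] H2, ∀ a b φ, ⟪b, A φ a⟫ = ⟪tmul a b, φ⟫ := by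
  have hn : ∀ a b, ‖tmul a b‖ = ‖a‖ * ‖b‖ := by
    intro a b
    have h := h_inner a a b b
    rw [inner_self_eq_norm_sq_to_K, inner_self_eq_norm_sq_to_K, inner_self_eq_norm_sq_to_K] at h
    have h2 : ‖tmul a b‖ ^ 2 = (‖a‖ * ‖b‖) ^ 2 := by
      rw [mul_pow]; exact_mod_cast h
    exact (sq_eq_sq₀ (norm_nonneg _) (by positivity)).1 h2
  let T : H1 → H2 →L[ℂ] E := fun a => (tmul a).mkContinuous ‖a‖ (fun b => (hn a b).le)
  have hT : ∀ a b, T a b = tmul a b := fun a b => rfl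
  have hTn : ∀ a, ‖T a‖ ≤ ‖a‖ := fun a => LinearMap.mkContinuous_norm_le _ (norm_nonneg _) _
  refine ⟨LinearMap.mkContinuous₂
    (LinearMap.mk₂'ₛₗ (RingHom.id ℂ) (starRingEnd ℂ)
      (fun φ a => ContinuousLinearMap.adjoint (T a) φ) ?_ ?_ ?_ ?_) 1 ?_, ?_⟩
  · intro m n a; simp
  · intro c m a; simp
  · intro φ a a'
    refine ext_inner_left ℂ fun b => ?_
    simp [ContinuousLinearMap.adjoint_inner_right, hT, inner_add_left, inner_add_right]
  · intro c φ a
    refine ext_inner_left ℂ fun b => ?_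
    simp [ContinuousLinearMap.adjoint_inner_right, hT, inner_smul_left, inner_smul_right]
  · intro φ a
    simp only [LinearMap.mk₂'ₛₗ_apply]
    refine (ContinuousLinearMap.le_opNorm _ _).trans ?_
    rw [LinearIsometryEquiv.norm_map, one_mul, mul_comm]
    exact mul_le_mul_of_nonneg_left (hTn a) (norm_nonneg _)
  · intro a b φ
    simp [ContinuousLinearMap.adjoint_inner_right, hT]

theorem contraction_compact
    {H1 H2 E : Type*}
    [NormedAddCommGroup H1] [InnerProductSpace ℂ H1]
    [NormedAddCommGroup H2] [InnerProductSpace ℂ H2] [CompleteSpace H2]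
    [NormedAddCommGroup E] [InnerProductSpace ℂ E]
    (tmul : H1 →ₗ[ℂ] H2 →ₗ[ℂ] E)
    (h_inner : ∀ (a c : H1) (b d : H2), ⟪tmul a b, tmul c d⟫ = ⟪a, c⟫ * ⟪b, d⟫)
    (h_dense : (Submodule.span ℂ {x : E | ∃ a b, tmul a b = x}).topologicalClosure = ⊤)
    (A : E →L[ℂ] H1 →L⋆[ℂ] H2) (hA : ∀ a b φ, ⟪b, A φ a⟫ = ⟪tmul a b, φ⟫) (ψ : E) :
    IsCompactOperator (A ψ) := by
  let K : Submodule ℂ E := (compactOperator (starRingEnd ℂ) H1 H2).comap A.toLinearMap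
  have hK : IsClosed (K : Set E) := by
    have : IsClosed {f : H1 →L⋆[ℂ] H2 | IsCompactOperator f} :=
      isClosed_setOfPred_isCompactOperator
    exact this.preimage A.continuous
  have hle : Submodule.span ℂ {x : E | ∃ a b, tmul a b = x} ≤ K := by
    rw [Submodule.span_le]
    rintro _ ⟨c, d, rfl⟩
    change IsCompactOperator (A (tmul c d))
    let g : H1 →L⋆[ℂ] ℂ := (innerSL ℂ).flip c
    have hg : IsCompactOperator g := isCompactOperator_of_locallyCompactSpace_dom g
    have h2 := hg.continuous_comp (g := fun z : ℂ => z • d) (by fun_prop)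
    have h4 : (A (tmul c d) : H1 → H2) = (fun z : ℂ => z • d) ∘ g := ?_
    · rw [h4]; exact h2
    funext a
    refine ext_inner_left ℂ fun b => ?_
    rw [hA, h_inner]
    simp [g, inner_smul_right]
  have h3 := Submodule.topologicalClosure_minimal _ hle hK
  rw [h_dense] at h3
  exact h3 (Submodule.mem_top : ψ ∈ ⊤)

universe v

theorem exists_eigenbasis {H : Type v} [NormedAddCommGroup H] [InnerProductSpace ℂ H]
    [CompleteSpace H] (S : H →L[ℂ] H) (hc : IsCompactOperator S)
    (hs : (S : H →ₗ[ℂ] H).IsSymmetric) :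
    ∃ (ι : Type v) (u : ι → H) (μ : ι → ℂ), Orthonormal ℂ u ∧ (∀ i, S (u i) = μ i • u i) ∧
      (Submodule.span ℂ (Set.range u)).topologicalClosure = ⊤ := by
  have hbot := ContinuousLinearMap.orthogonalComplement_iSup_eigenspaces_eq_bot hc hs
  let V : ℂ → Submodule ℂ H := fun μ => Module.End.eigenspace (S : Module.End ℂ H) μ
  have hVc : ∀ μ, IsClosed (V μ : Set H) := fun μ =>
    ContinuousLinearMap.isClosed_eigenspace S μ
  have : ∀ μ, CompleteSpace (V μ) := fun μ => (hVc μ).completeSpace_coe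
  choose w b hb using fun μ => exists_hilbertBasis ℂ (V μ)
  have ho := hs.orthogonalFamily_eigenspaces
  refine ⟨Σ μ, w μ, fun p => (b p.1 p.2 : V p.1), fun p => p.1, ?_, ?_, ?_⟩
  · exact ho.orthonormal_sigma_orthonormal (fun μ => (b μ).orthonormal)
  · rintro ⟨μ, i⟩
    exact Module.End.mem_eigenspace_iff.1 (b μ i).2
  · rw [Submodule.topologicalClosure_eq_top_iff, eq_bot_iff]
    intro x hx
    rw [← hbot, Submodule.mem_orthogonal']
    intro y hy
    have hle : (⨆ μ, V μ) ≤ LinearMap.ker (innerSL ℂ x).toLinearMap := by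
      refine iSup_le fun μ v hv => ?_
      have h0 : (innerSL ℂ x).comp (V μ).subtypeL = 0 := by
        apply ContinuousLinearMap.ext_on (s := Set.range (b μ))
        · rw [Submodule.dense_iff_topologicalClosure_eq_top]; exact (b μ).dense_span
        · rintro _ ⟨i, rfl⟩
          exact (Submodule.mem_orthogonal' _ _).1 hx _ (Submodule.subset_span ⟨⟨μ, i⟩, rfl⟩)
      exact congrArg (fun L => L (⟨v, hv⟩ : V μ)) h0
    exact hle hy

theorem main
    {H1 : Type v} {H2 E : Type*}
    [NormedAddCommGroup H1] [InnerProductSpace ℂ H1] [CompleteSpace H1]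
    [NormedAddCommGroup H2] [InnerProductSpace ℂ H2] [CompleteSpace H2]
    [NormedAddCommGroup E] [InnerProductSpace ℂ E] [CompleteSpace E]
    (tmul : H1 →ₗ[ℂ] H2 →ₗ[ℂ] E)
    (h_inner : ∀ (a c : H1) (b d : H2), ⟪tmul a b, tmul c d⟫ = ⟪a, c⟫ * ⟪b, d⟫)
    (h_dense : (Submodule.span ℂ {x : E | ∃ a b, tmul a b = x}).topologicalClosure = ⊤)
    (ψ : E) :
    ∃ (J : Type v) (e : J → H1) (f : J → H2) (lam : J → ℝ),
      Orthonormal ℂ e ∧ Orthonormal ℂ f ∧ (∀ j, 0 < lam j) ∧ Summable (fun j => lam j ^ 2) ∧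
      HasSum (fun j => (lam j : ℂ) • tmul (e j) (f j)) ψ := by
  obtain ⟨A, hA⟩ := exists_contraction tmul h_inner
  obtain ⟨B, hB⟩ := exists_contraction tmul.flip
    (fun a c b d => by simp [h_inner, mul_comm])
  simp only [LinearMap.flip_apply] at hB
  let S : H1 →L[ℂ] H1 := (B ψ).comp (A ψ)
  have hS : ∀ a a', ⟪a', S a⟫ = ⟪A ψ a, A ψ a'⟫ := by
    intro a a'
    simp [S, hB, hA]
  have hSc : IsCompactOperator S :=
    (contraction_compact tmul h_inner h_dense A hA ψ).clm_comp (B ψ)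
  have hSs : (S : H1 →ₗ[ℂ] H1).IsSymmetric := by
    intro x y
    change ⟪S x, y⟫ = ⟪x, S y⟫
    rw [hS, ← inner_conj_symm, hS, inner_conj_symm]
  obtain ⟨ι, u, μ, hu, hSu, hd⟩ := exists_eigenbasis S hSc hSs
  classical
  have horth : ∀ i j, i ≠ j → ⟪A ψ (u i), A ψ (u j)⟫ = 0 := by
    intro i j hij
    rw [← hS, hSu, inner_smul_right, hu.2 hij.symm, mul_zero]
  let J := {i : ι // A ψ (u i) ≠ 0}
  let lam : J → ℝ := fun j => ‖A ψ (u j.1)‖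
  have hlam : ∀ j, 0 < lam j := fun j => norm_pos_iff.2 j.2
  let f : J → H2 := fun j => ((lam j : ℂ)⁻¹) • A ψ (u j.1)
  have hlf : ∀ j, (lam j : ℂ) • f j = A ψ (u j.1) := by
    intro j
    have : (lam j : ℂ) ≠ 0 := by exact_mod_cast (hlam j).ne'
    simp [f, smul_smul, this]
  have he : Orthonormal ℂ (fun j : J => u j.1) := hu.comp _ Subtype.val_injective
  have hf : Orthonormal ℂ f := by
    constructor
    · intro j
      have := (hlam j).ne'
      simp only [f, norm_smul, norm_inv, Complex.norm_real, lam, norm_norm]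
      exact inv_mul_cancel₀ this
    · intro i j hij
      have h0 := horth i.1 j.1 (fun h => hij (Subtype.ext h))
      simp only [f, inner_smul_left, inner_smul_right, h0, mul_zero]
  let g : J → E := fun j => tmul (u j.1) (f j)
  have hg : Orthonormal ℂ g := by
    rw [orthonormal_iff_ite] at he hf ⊢
    intro i j
    simp only [g, h_inner, he, hf]
    split_ifs <;> simp
  have hgψ : ∀ j, ⟪g j, ψ⟫ = (lam j : ℂ) := by
    intro j
    simp only [g]
    rw [← hA, ← hlf, inner_smul_right, inner_self_eq_norm_sq_to_K, hf.1 j]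
    simp
  have hsq : Summable (fun j => lam j ^ 2) := by
    have := hg.inner_products_summable ψ
    simpa [hgψ] using this
  have hsum : Summable (fun j => (lam j : ℂ) • g j) := by
    have := hg.orthogonalFamily.summable_iff_norm_sq_summable (fun j => (lam j : ℂ))
    simp only [LinearIsometry.toSpanSingleton_apply] at this
    rw [this]
    simpa using hsq
  refine ⟨J, fun j => u j.1, f, lam, he, hf, hlam, hsq, ?_⟩
  suffices h : ∑' j, (lam j : ℂ) • g j = ψ by
    have h5 := hsum.hasSum
    rw [h] at h5
    exact h5
  set φ := ∑' j, (lam j : ℂ) • g j with hφ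
  have hAu : ∀ i, A φ (u i) = A ψ (u i) := by
    intro i
    refine ext_inner_left ℂ fun b => ?_
    have h1 : HasSum (fun j : J => ⟪tmul (u i) b, (lam j : ℂ) • g j⟫) ⟪tmul (u i) b, φ⟫ :=
      hsum.hasSum.mapL (innerSL ℂ (tmul (u i) b))
    rw [hA]
    refine h1.unique ?_
    by_cases hi : A ψ (u i) = 0
    · rw [hi, inner_zero_right]
      convert hasSum_zero using 2 with j
      have : i ≠ j.1 := fun h => j.2 (h ▸ hi)
      simp [g, inner_smul_right, h_inner, hu.2 this]
    · convert hasSum_single (⟨i, hi⟩ : J) ?_ using 1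
      · rw [← hlf ⟨i, hi⟩]
        have hgi : ⟪tmul (u i) b, g ⟨i, hi⟩⟫ = ⟪b, f ⟨i, hi⟩⟫ := by
          simp only [g]
          rw [h_inner, inner_self_eq_norm_sq_to_K, hu.1 i]
          simp
        exact (inner_smul_right b (f ⟨i, hi⟩) (lam ⟨i, hi⟩ : ℂ)).trans
          ((congrArg (fun z => (lam ⟨i, hi⟩ : ℂ) * z) hgi.symm).trans
            (inner_smul_right _ _ _).symm)
      · intro j hj
        have : i ≠ j.1 := fun h => hj (Subtype.ext h.symm)
        simp [g, inner_smul_right, h_inner, hu.2 this]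
  have hAeq : A φ = A ψ := by
    apply ContinuousLinearMap.ext_on (s := Set.range u)
    · rw [Submodule.dense_iff_topologicalClosure_eq_top]; exact hd
    · rintro _ ⟨i, rfl⟩; exact hAu i
  have hd' : Dense ((Submodule.span ℂ {x : E | ∃ a b, tmul a b = x} : Submodule ℂ E) : Set E) :=
    Submodule.dense_iff_topologicalClosure_eq_top.2 h_dense
  have : innerSL ℂ φ = innerSL ℂ ψ := by
    apply ContinuousLinearMap.ext_on hd'
    rintro _ ⟨a, b, rfl⟩
    simp only [innerSL_apply_apply]
    rw [← inner_conj_symm, ← hA, hAeq, hA, inner_conj_symm]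
  exact (innerSL_inj.1 this)

theorem exists_enum (J : Type*) [Countable J] :
    ∃ N : ℕ∞, Nonempty ({k : ℕ // (k : ℕ∞) < N} ≃ J) := by
  rcases finite_or_infinite J with h | h
  · obtain ⟨n, ⟨en⟩⟩ := Finite.exists_equiv_fin J
    refine ⟨n, ⟨Equiv.trans ?_ en.symm⟩⟩
    exact (Equiv.subtypeEquivRight (by simp)).trans Fin.equivSubtype.symm
  · obtain ⟨d⟩ := nonempty_denumerable J
    refine ⟨⊤, ⟨Equiv.trans ?_ (Denumerable.eqv J).symm⟩⟩
    exact Equiv.subtypeUnivEquiv (by simp)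

end SchmidtAux

/-- **Schmidt decomposition** in separable Hilbert spaces: any element `ψ` of the Hilbert
space tensor product `E = H1 ⊗ H2` (encoded by a bilinear map `tmul` whose elementary tensors
satisfy the tensor inner product law and span a dense subspace) can be written as
`ψ = Σₖ λₖ (eₖ ⊗ fₖ)` with `(eₖ)`, `(fₖ)` orthonormal, `λₖ ≥ 0`, and `λₖ → 0` if there are
infinitely many terms; convergence holds in the norm of `E`. -/
theorem schmidt_decomposition
    {H1 H2 E : Type*}
    [NormedAddCommGroup H1] [InnerProductSpace ℂ H1] [CompleteSpace H1]
    [TopologicalSpace.SeparableSpace H1]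
    [NormedAddCommGroup H2] [InnerProductSpace ℂ H2] [CompleteSpace H2]
    [TopologicalSpace.SeparableSpace H2]
    [NormedAddCommGroup E] [InnerProductSpace ℂ E] [CompleteSpace E]
    (tmul : H1 →ₗ[ℂ] H2 →ₗ[ℂ] E)
    (h_inner : ∀ (a c : H1) (b d : H2), ⟪tmul a b, tmul c d⟫ = ⟪a, c⟫ * ⟪b, d⟫)
    (h_dense : (Submodule.span ℂ {x : E | ∃ a b, tmul a b = x}).topologicalClosure = ⊤)
    (ψ : E) :
    ∃ (N : ℕ∞) (e : ℕ → H1) (f : ℕ → H2) (lam : ℕ → ℝ),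
      Orthonormal ℂ (fun k : {k : ℕ // (k : ℕ∞) < N} => e k.1) ∧
      Orthonormal ℂ (fun k : {k : ℕ // (k : ℕ∞) < N} => f k.1) ∧
      (∀ k : ℕ, (k : ℕ∞) < N → 0 ≤ lam k) ∧
      (N = ⊤ → Tendsto lam atTop (𝓝 0)) ∧
      HasSum (fun k : {k : ℕ // (k : ℕ∞) < N} => (lam k.1 : ℂ) • tmul (e k.1) (f k.1)) ψ := by
  classical
  obtain ⟨J, e, f, lam, he, hf, hpos, hsq, hsum⟩ := SchmidtAux.main tmul h_inner h_dense ψ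
  have hJ : Countable J := by
    have h := hsq.countable_support
    have hU : Function.support (fun j => lam j ^ 2) = Set.univ := by
      ext j; simp [(hpos j).ne']
    rw [hU] at h
    exact Set.countable_univ_iff.1 h
  obtain ⟨N, ⟨σ⟩⟩ := SchmidtAux.exists_enum J
  refine ⟨N, fun k => if h : (k : ℕ∞) < N then e (σ ⟨k, h⟩) else 0,
    fun k => if h : (k : ℕ∞) < N then f (σ ⟨k, h⟩) else 0,
    fun k => if h : (k : ℕ∞) < N then lam (σ ⟨k, h⟩) else 0, ?_, ?_, ?_, ?_, ?_⟩
  · convert he.comp σ σ.injective using 2 with k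
    simp [k.2]
  · convert hf.comp σ σ.injective using 2 with k
    simp [k.2]
  · intro k hk
    simp [hk, (hpos _).le]
  · rintro rfl
    have h0 : Tendsto lam cofinite (𝓝 0) := by
      have h1 := hsq.tendsto_cofinite_zero.sqrt
      simpa [Real.sqrt_sq (hpos _).le] using h1
    have h2 : Function.Injective (fun k : ℕ => σ ⟨k, ENat.natCast_lt_top k⟩) := by
      intro a b hab
      simpa using σ.injective hab
    have h3 := h0.comp h2.tendsto_cofinite
    rw [Nat.cofinite_eq_atTop] at h3
    refine h3.congr fun k => ?_
    simp
  · convert (σ.hasSum_iff (f := fun j => (lam j : ℂ) • tmul (e j) (f j))).2 hsum using 2 with k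
    simp [k.2]
end

section
/- For ω > 0 and real s, t, the two-variable exponential generating function of the integrals I_{i,j} = ∫_{-∞}^{∞} exp(-(1+ω)x²/2) H_i(x) H_j(√ω x) dx satisfies Σ_{i,j≥0} I_{i,j} s^i t^j/(i! j!) = √(2π/(1+ω)) · exp( 2(√ω t + s)²/(1+ω) − s² − t² ). -/
open MeasureTheory Polynomial

/-- The physicists' Hermite polynomials, `H₀ = 1`, `H_{n+1} = 2x Hₙ - Hₙ'`; they satisfy the
generating function identity `Σₙ Hₙ(x) tⁿ/n! = exp (2xt - t²)`. -/
noncomputable def physHermite : ℕ → Polynomial ℝ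
  | 0 => 1
  | n + 1 => 2 * Polynomial.X * physHermite n - Polynomial.derivative (physHermite n)


theorem physHermite_derivative (n : ℕ) :
    derivative (physHermite (n + 1)) = C (2 * ((n : ℝ) + 1)) * physHermite n := by
  induction n with
  | zero =>
    simp [physHermite]
    rfl
  | succ n ih =>
    rw [physHermite, derivative_sub, derivative_mul, ih, derivative_C_mul]
    have h : physHermite (n + 1) = 2 * X * physHermite n - derivative (physHermite n) := rfl
    have h2 : derivative (physHermite n) = 2 * X * physHermite n - physHermite (n + 1) := by
      rw [h]; ring
    rw [h2]
    have h3 : derivative (2 * X : ℝ[X]) = 2 := by simp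
    rw [h3]
    simp only [map_mul, map_add, map_one, map_natCast, map_ofNat, Nat.cast_add, Nat.cast_one]
    ring

theorem physHermite_rec (n : ℕ) (x : ℝ) :
    (physHermite (n + 2)).eval x
      = 2 * x * (physHermite (n + 1)).eval x - 2 * ((n : ℝ) + 1) * (physHermite n).eval x := by
  rw [physHermite, physHermite_derivative]
  simp

noncomputable def bCoef (ε : ℝ) (l : ℕ) : ℝ :=
  if Even l then ε ^ (l / 2) / ((l / 2).factorial : ℝ) else 0

noncomputable def aCoef (y : ℝ) (k : ℕ) : ℝ := (2 * y) ^ k / (k.factorial : ℝ)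

noncomputable def cCoef (ε y : ℝ) (n : ℕ) : ℝ :=
  ∑ kl ∈ Finset.HasAntidiagonal.antidiagonal n, aCoef y kl.1 * bCoef ε kl.2

theorem bCoef_one (ε : ℝ) : bCoef ε 1 = 0 := by simp [bCoef]

theorem bCoef_rec (ε : ℝ) (l : ℕ) : bCoef ε (l + 2) * ((l : ℝ) + 2) = 2 * ε * bCoef ε l := by
  unfold bCoef
  by_cases h : Even l
  · obtain ⟨m, rfl⟩ := h
    have h1 : Even (m + m + 2) := ⟨m + 1, by ring⟩
    have h2 : (m + m + 2) / 2 = m + 1 := by omega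
    have h3 : (m + m) / 2 = m := by omega
    rw [if_pos h1, if_pos ⟨m, rfl⟩, h2, h3, Nat.factorial_succ]
    have : (m.factorial : ℝ) ≠ 0 := by positivity
    push_cast
    field_simp
    ring
  · have h1 : ¬ Even (l + 2) := by simpa [Nat.even_add] using h
    simp [h, h1]

theorem aCoef_rec (y : ℝ) (k : ℕ) : aCoef y (k + 1) * ((k : ℝ) + 1) = 2 * y * aCoef y k := by
  unfold aCoef
  rw [Nat.factorial_succ]
  have : (k.factorial : ℝ) ≠ 0 := by positivity
  push_cast
  field_simp
  ring

theorem cCoef_series (ε y : ℝ) :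
    PowerSeries.mk (cCoef ε y) = PowerSeries.mk (aCoef y) * PowerSeries.mk (bCoef ε) := by
  ext n
  simp [PowerSeries.coeff_mul, cCoef]

theorem cCoef_ode (ε y : ℝ) :
    PowerSeries.derivative ℝ (PowerSeries.mk (cCoef ε y))
      = PowerSeries.C (2 * y) * PowerSeries.mk (cCoef ε y)
        + PowerSeries.C (2 * ε) * (PowerSeries.mk (cCoef ε y) * PowerSeries.X) := by
  have hA : PowerSeries.derivative ℝ (PowerSeries.mk (aCoef y))
      = PowerSeries.C (2 * y) * PowerSeries.mk (aCoef y) := by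
    ext n
    simpa only [PowerSeries.coeff_derivative, PowerSeries.coeff_mk, PowerSeries.coeff_C_mul] using aCoef_rec y n
  have hB : PowerSeries.derivative ℝ (PowerSeries.mk (bCoef ε))
      = PowerSeries.C (2 * ε) * (PowerSeries.mk (bCoef ε) * PowerSeries.X) := by
    ext n
    rw [PowerSeries.coeff_C_mul]
    cases n with
    | zero => simp [PowerSeries.coeff_derivative, bCoef_one]
    | succ n =>
      rw [PowerSeries.coeff_succ_mul_X]
      simp only [PowerSeries.coeff_derivative, PowerSeries.coeff_mk]
      rw [← bCoef_rec]
      push_cast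
      ring
  rw [cCoef_series, Derivation.leibniz, hA, hB]
  simp only [smul_eq_mul]
  ring

theorem cCoef_rec (ε y : ℝ) (n : ℕ) :
    cCoef ε y (n + 2) * ((n : ℝ) + 2) = 2 * y * cCoef ε y (n + 1) + 2 * ε * cCoef ε y n := by
  have h := congrArg (PowerSeries.coeff (n + 1)) (cCoef_ode ε y)
  rw [map_add, PowerSeries.coeff_C_mul, PowerSeries.coeff_C_mul,
    PowerSeries.coeff_succ_mul_X] at h
  simp only [PowerSeries.coeff_derivative, PowerSeries.coeff_mk] at h
  rw [← h]
  push_cast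
  ring

theorem physHermite_eq (x : ℝ) (n : ℕ) :
    (physHermite n).eval x = cCoef (-1) x n * (n.factorial : ℝ) ∧
    (physHermite (n + 1)).eval x = cCoef (-1) x (n + 1) * ((n + 1).factorial : ℝ) := by
  induction n with
  | zero =>
    constructor
    · simp [physHermite, cCoef, aCoef, bCoef]
    · simp [physHermite, cCoef, aCoef, bCoef, Finset.Nat.antidiagonal_succ]
  | succ n ih =>
    refine ⟨ih.2, ?_⟩
    have h := cCoef_rec (-1) x n
    rw [physHermite_rec, ih.1, ih.2]
    simp only [Nat.factorial_succ]
    push_cast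
    linear_combination (-((n : ℝ) + 1) * (n.factorial : ℝ)) * h

theorem hasSum_aCoef (y t : ℝ) : HasSum (fun k => aCoef y k * t ^ k) (Real.exp (2 * y * t)) := by
  have h := NormedSpace.expSeries_div_hasSum_exp (𝔸 := ℝ) (2 * y * t)
  rw [← Real.exp_eq_exp_ℝ] at h
  refine h.congr_fun ?_
  intro k
  simp only [aCoef, mul_pow]
  ring

theorem hasSum_bCoef (ε t : ℝ) : HasSum (fun k => bCoef ε k * t ^ k) (Real.exp (ε * t ^ 2)) := by
  have h := NormedSpace.expSeries_div_hasSum_exp (𝔸 := ℝ) (ε * t ^ 2)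
  rw [← Real.exp_eq_exp_ℝ] at h
  have hi : Function.Injective (fun m : ℕ => 2 * m) := fun a b hab => by
    have : 2 * a = 2 * b := hab
    omega
  rw [← hi.hasSum_iff]
  · refine h.congr_fun ?_
    intro m
    simp [bCoef, mul_pow, pow_mul]
    ring
  · intro l hl
    have : ¬ Even l := by
      rintro ⟨m, rfl⟩
      exact hl ⟨m, by simp only; ring⟩
    simp [bCoef, this]

theorem hasSum_cCoef (ε y t : ℝ) :
    HasSum (fun n => cCoef ε y n * t ^ n) (Real.exp (2 * y * t + ε * t ^ 2)) := by
  have ha := hasSum_aCoef y t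
  have hb := hasSum_bCoef ε t
  have h1 := ha.summable.norm
  have h2 := hb.summable.norm
  have e := tsum_mul_tsum_eq_tsum_sum_antidiagonal_of_summable_norm h1 h2
  have hs := (summable_norm_sum_mul_antidiagonal_of_summable_norm h1 h2).of_norm
  have h := hs.hasSum
  rw [← e, ha.tsum_eq, hb.tsum_eq, ← Real.exp_add] at h
  refine h.congr_fun ?_
  intro n
  rw [cCoef, Finset.sum_mul]
  refine Finset.sum_congr rfl fun kl hkl => ?_
  rw [← Finset.HasAntidiagonal.mem_antidiagonal.mp hkl, pow_add]
  ring

theorem abs_cCoef_le (y : ℝ) (n : ℕ) : |cCoef (-1) y n| ≤ cCoef 1 |y| n := by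
  unfold cCoef
  refine (Finset.abs_sum_le_sum_abs _ _).trans (Finset.sum_le_sum fun kl _ => ?_)
  rw [abs_mul]
  apply le_of_eq
  congr 1
  · simp [aCoef, abs_div, abs_mul, abs_pow]
  · unfold bCoef
    split_ifs <;> simp [abs_div]

theorem cCoef_nonneg (y : ℝ) (n : ℕ) : 0 ≤ cCoef 1 |y| n :=
  (abs_nonneg _).trans (abs_cCoef_le y n)

theorem gauss_aux (a b : ℝ) (ha : 0 < a) :
    Integrable (fun x : ℝ => Real.exp (-a * x ^ 2 + b * x)) ∧
    ∫ x : ℝ, Real.exp (-a * x ^ 2 + b * x)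
      = Real.sqrt (Real.pi / a) * Real.exp (b ^ 2 / (4 * a)) := by
  have e : (fun x : ℝ => Real.exp (-a * x ^ 2 + b * x))
      = fun x => Real.exp (-a * (x - b / (2 * a)) ^ 2) * Real.exp (b ^ 2 / (4 * a)) := by
    funext x
    rw [← Real.exp_add]
    congr 1
    field_simp
    ring
  rw [e]
  constructor
  · exact ((integrable_exp_neg_mul_sq ha).comp_sub_right (b / (2 * a))).mul_const _
  · rw [integral_mul_const,
      integral_sub_right_eq_self (fun x : ℝ => Real.exp (-a * x ^ 2)) (b / (2 * a)),
      integral_gaussian]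

theorem gauss_abs_aux (a b : ℝ) (ha : 0 < a) :
    Integrable (fun x : ℝ => Real.exp (-a * x ^ 2 + b * |x|)) := by
  refine ((gauss_aux a b ha).1.add (gauss_aux a (-b) ha).1).mono'
    (Continuous.aestronglyMeasurable (by fun_prop)) (Filter.Eventually.of_forall fun x => ?_)
  rw [Real.norm_eq_abs, Real.abs_exp]
  simp only [Pi.add_apply]
  rcases abs_cases x with h | h <;> rw [h.1]
  · have := Real.exp_pos (-a * x ^ 2 + -b * x)
    linarith
  · have := Real.exp_pos (-a * x ^ 2 + b * x)
    have e : b * -x = -b * x := by ring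
    rw [e]
    linarith

theorem hasSum_prod_aux (ε y z s t g : ℝ) :
    HasSum (fun p : ℕ × ℕ => g * ((cCoef ε y p.1 * s ^ p.1) * (cCoef ε z p.2 * t ^ p.2)))
      (g * (Real.exp (2 * y * s + ε * s ^ 2) * Real.exp (2 * z * t + ε * t ^ 2))) := by
  have h1 := hasSum_cCoef ε y s
  have h2 := hasSum_cCoef ε z t
  exact (h1.mul h2 (summable_mul_of_summable_norm h1.summable.norm h2.summable.norm)).mul_left g

/-- For `ω > 0` and real `s, t`, the two-variable exponential generating function of the
integrals `I i j = ∫ exp(-(1+ω)x²/2) Hᵢ(x) Hⱼ(√ω x) dx` satisfies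
`Σ_{i,j} I i j sⁱ tʲ/(i! j!) = √(2π/(1+ω)) exp(2(√ω t + s)²/(1+ω) - s² - t²)`. -/
theorem hermite_integral_generating_function (ω : ℝ) (hω : 0 < ω) (s t : ℝ) :
    HasSum
      (fun p : ℕ × ℕ =>
        (∫ x : ℝ, Real.exp (-(1 + ω) * x ^ 2 / 2) * (physHermite p.1).eval x *
            (physHermite p.2).eval (Real.sqrt ω * x)) *
          s ^ p.1 * t ^ p.2 / ((p.1.factorial : ℝ) * (p.2.factorial : ℝ)))
      (Real.sqrt (2 * Real.pi / (1 + ω)) *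
        Real.exp (2 * (Real.sqrt ω * t + s) ^ 2 / (1 + ω) - s ^ 2 - t ^ 2)) := by
  have ha : 0 < (1 + ω) / 2 := by positivity
  set r := Real.sqrt ω with hr
  have hr0 : 0 ≤ r := Real.sqrt_nonneg _
  let F : ℕ × ℕ → ℝ → ℝ := fun p x => Real.exp (-(1 + ω) * x ^ 2 / 2) *
    ((cCoef (-1) x p.1 * s ^ p.1) * (cCoef (-1) (r * x) p.2 * t ^ p.2))
  let B : ℕ × ℕ → ℝ → ℝ := fun p x => Real.exp (-(1 + ω) * x ^ 2 / 2) *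
    ((cCoef 1 |x| p.1 * |s| ^ p.1) * (cCoef 1 |r * x| p.2 * |t| ^ p.2))
  have hF : ∀ p x, F p x = (Real.exp (-(1 + ω) * x ^ 2 / 2) * (physHermite p.1).eval x *
            (physHermite p.2).eval (r * x)) *
          (s ^ p.1 * t ^ p.2 / ((p.1.factorial : ℝ) * (p.2.factorial : ℝ))) := by
    intro p x
    have h1 : (p.1.factorial : ℝ) ≠ 0 := by positivity
    have h2 : (p.2.factorial : ℝ) ≠ 0 := by positivity
    simp only [F]
    rw [(physHermite_eq x p.1).1, (physHermite_eq (r * x) p.2).1]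
    field_simp
  have key : HasSum (fun p => ∫ x, F p x) (∫ x, Real.exp (-(1 + ω) * x ^ 2 / 2) *
      (Real.exp (2 * x * s + (-1) * s ^ 2) * Real.exp (2 * (r * x) * t + (-1) * t ^ 2))) := by
    refine hasSum_integral_of_dominated_convergence B ?_ ?_ ?_ ?_ ?_
    · intro p
      have : F p = fun x => _ := funext (hF p)
      rw [this]
      refine Continuous.aestronglyMeasurable ?_
      have h1 := (physHermite p.1).continuous
      have h2 := (physHermite p.2).continuous
      have h3 : Continuous fun x : ℝ => (physHermite p.2).eval (r * x) :=
        h2.comp (by fun_prop)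
      exact (((by fun_prop : Continuous fun x : ℝ => Real.exp (-(1 + ω) * x ^ 2 / 2)).mul
        h1).mul h3).mul continuous_const
    · intro p
      refine Filter.Eventually.of_forall fun x => ?_
      simp only [F, B, Real.norm_eq_abs, abs_mul, Real.abs_exp, abs_pow]
      have h1 := abs_cCoef_le x p.1
      have h2 := abs_cCoef_le (r * x) p.2
      have h3 := cCoef_nonneg x p.1
      rw [abs_mul] at h2
      gcongr
    · exact Filter.Eventually.of_forall fun x => (hasSum_prod_aux 1 _ _ _ _ _).summable
    · have e : (fun x => ∑' p, B p x) = fun x : ℝ =>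
          Real.exp (-((1 + ω) / 2) * x ^ 2 + (2 * |s| + 2 * r * |t|) * |x|)
            * Real.exp (s ^ 2 + t ^ 2) := by
        funext x
        rw [(hasSum_prod_aux 1 |x| |r * x| |s| |t| _).tsum_eq, ← Real.exp_add, ← Real.exp_add,
          ← Real.exp_add, abs_mul, abs_of_nonneg hr0, sq_abs, sq_abs]
        congr 1
        ring
      rw [e]
      exact (gauss_abs_aux _ _ ha).mul_const _
    · exact Filter.Eventually.of_forall fun x => hasSum_prod_aux (-1) _ _ _ _ _
  have e : (fun x : ℝ => Real.exp (-(1 + ω) * x ^ 2 / 2) *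
      (Real.exp (2 * x * s + (-1) * s ^ 2) * Real.exp (2 * (r * x) * t + (-1) * t ^ 2)))
      = fun x => Real.exp (-((1 + ω) / 2) * x ^ 2 + (2 * (r * t + s)) * x)
        * Real.exp (-s ^ 2 - t ^ 2) := by
    funext x
    rw [← Real.exp_add, ← Real.exp_add, ← Real.exp_add]
    congr 1
    ring
  rw [e, integral_mul_const, (gauss_aux _ _ ha).2, mul_assoc, ← Real.exp_add] at key
  convert key using 1
  · funext p
    simp only [hF]
    rw [integral_mul_const]
    ring
  · congr 2
    · field_simp
    · field_simp
      ring
end
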